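/- Let μ be a nonempty Young diagram and N ≥ 0. Then the number of semistandard Young tableaux of shape μ with entries in {0, …, N−1}, multiplied by ∏_{(i,j) ∈ μ} h(i,j), equals ∏_{(i,j) ∈ μ} (N + j − i), where the products run over all cells of μ and the second product is a product of integers. (This is the Hook Content Formula: #SSYT(N, μ) = ∏_{(i,j)∈μ} (N + j − i)/h(i,j).) -/

import Mathlib

/-- The hook length of the cell `(i, j)` (row `i`, column `j`, `0`-indexed) of a Young
diagram `μ`: `h(i,j) = (μ_i - j) + (μ'_j - i) - 1`. -/
def hookLen (μ : YoungDiagram) (i j : ℕ) : ℕ :=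
  (μ.rowLen i - j) + (μ.colLen j - i) - 1

def SS (r : ℕ → ℕ) (N : ℕ) (T : ℕ → ℕ → ℕ) : Prop :=
  (∀ i j1 j2, j1 < j2 → j2 < r i → T i j1 ≤ T i j2) ∧
  (∀ i1 i2 j, i1 < i2 → j < r i2 → T i1 j < T i2 j) ∧
  (∀ i j, r i ≤ j → T i j = 0) ∧ (∀ i j, j < r i → T i j < N)

def extT (r s : ℕ → ℕ) (N : ℕ) (T : ℕ → ℕ → ℕ) : ℕ → ℕ → ℕ :=
  fun i j => if j < s i then T i j else if j < r i then N else 0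

def shp (N : ℕ) (l : Fin N → ℕ) (i : ℕ) : ℕ :=
  if h : i < N then l (Fin.rev ⟨i, h⟩) - (N - 1 - i) else 0

lemma extT_mem {r s : ℕ → ℕ} {N : ℕ} {T : ℕ → ℕ → ℕ} (hr : Antitone r)
    (h1 : ∀ i, s i ≤ r i) (h2 : ∀ i, r (i+1) ≤ s i) (hT : SS s N T) :
    SS r (N+1) (extT r s N T) := by
  obtain ⟨a, b, c, d⟩ := hT
  refine ⟨?_, ?_, ?_, ?_⟩
  · intro i j1 j2 hj hj2
    have := a i j1 j2 hj
    have := d i j1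
    unfold extT
    split_ifs <;> grind
  · intro i1 i2 j hi hj
    have e1 : r i2 ≤ r (i1+1) := hr hi
    have e2 := h2 i1
    have := b i1 i2 j hi
    have := d i1 j
    unfold extT
    split_ifs <;> grind
  · intro i j hj
    have := h1 i
    unfold extT
    split_ifs <;> grind
  · intro i j hj
    have := d i j
    unfold extT
    split_ifs <;> grind

lemma extT_surj {r : ℕ → ℕ} {N : ℕ} {T : ℕ → ℕ → ℕ} (hr : Antitone r) 
    (hT : SS r (N+1) T) : ∃ s : ℕ → ℕ, (∀ i, s i ≤ r i) ∧ (∀ i, r (i+1) ≤ s i) ∧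
      (∀ i, N ≤ i → s i = 0) ∧ ∃ T', SS s N T' ∧ extT r s N T' = T := by
  obtain ⟨a, b, c, d⟩ := hT
  have hs : ∀ i, ∃ s, ∀ j, j < s ↔ j < r i ∧ T i j < N := by
    intro i
    have hex : ∃ j, ¬ (j < r i ∧ T i j < N) := ⟨r i, by simp⟩
    refine ⟨Nat.find hex, fun j => ⟨fun h => ?_, fun h => ?_⟩⟩
    · exact not_not.1 (Nat.find_min hex h)
    · rw [Nat.lt_find_iff]
      intro m hm
      rw [not_not]
      rcases hm.lt_or_eq with h' | rfl
      · have := a i m j h' h.1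
        omega
      · exact h
  choose s hs using hs
  have hge : ∀ i j, j < r i → i ≤ T i j := by
    intro i
    induction i with
    | zero => intro j _; exact Nat.zero_le _
    | succ i ih =>
      intro j hj
      have := b i (i+1) j (by omega) hj
      have := ih j (lt_of_lt_of_le hj (hr (by omega)))
      omega
  refine ⟨s, ?_, ?_, ?_, fun i j => if j < s i then T i j else 0, ⟨?_, ?_, ?_, ?_⟩, ?_⟩
  · intro i
    by_contra! h
    have := (hs i _).1 h
    omega
  · intro i
    by_contra! h
    have h1 := (hs i (s i)).not.1 (by omega)
    have h2 := b i (i+1) _ (by omega) h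
    have h3 := d (i+1) _ h
    have h4 : s i < r i := lt_of_lt_of_le h (hr (by omega))
    omega
  · intro i hi
    by_contra! h
    have := (hs i 0).1 (by omega)
    have := hge i 0 this.1
    omega
  · intro i j1 j2 hj hj2
    have := a i j1 j2 hj ((hs i j2).1 hj2).1
    simp only
    split_ifs <;> grind
  · intro i1 i2 j hi hj
    have h1 := (hs i2 j).1 hj
    have := b i1 i2 j hi h1.1
    have h2 : j < s i1 := (hs i1 j).2 ⟨lt_of_lt_of_le h1.1 (hr hi.le), by omega⟩
    simp [hj, h2, this]
  · intro i j hj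
    simp; omega
  · intro i j hj
    simp [hj, ((hs i j).1 hj).2]
  · ext i j
    unfold extT
    have := hs i j
    have := d i j
    have := c i j
    simp only
    split_ifs <;> grind

lemma extT_inj {r s s' : ℕ → ℕ} {N : ℕ} {T T' : ℕ → ℕ → ℕ}
    (h1 : ∀ i, s i ≤ r i) (h1' : ∀ i, s' i ≤ r i) (hT : SS s N T) (hT' : SS s' N T')
    (h : extT r s N T = extT r s' N T') : s = s' ∧ T = T' := by
  have key : ∀ (s : ℕ → ℕ) T, (∀ i, s i ≤ r i) → SS s N T → ∀ i j, 
      (j < s i ↔ j < r i ∧ extT r s N T i j < N) := by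
    intro s T h1 hT i j
    have := hT.2.2.2 i j
    have := h1 i
    unfold extT
    split_ifs <;> grind
  have hs : s = s' := by
    ext i
    have : ∀ j, j < s i ↔ j < s' i := by
      intro j
      rw [key s T h1 hT, key s' T' h1' hT', h]
    have h1 := this (s i)
    have h2 := this (s' i)
    omega
  subst hs
  refine ⟨rfl, ?_⟩
  ext i j
  have h3 := congrFun (congrFun h i) j
  by_cases hj : j < s i
  · simpa [extT, hj] using h3
  · rw [hT.2.2.1 i j (by omega), hT'.2.2.1 i j (by omega)]

lemma strictMono_le {N : ℕ} {l : Fin N → ℕ} (hl : StrictMono l) (k : ℕ) (hk : k < N) :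
    k ≤ l ⟨k, hk⟩ := by
  induction k with
  | zero => omega
  | succ k ih =>
    have := ih (by omega)
    have : l ⟨k, by omega⟩ < l ⟨k+1, hk⟩ := hl (by simp)
    omega

lemma shp_eq {N : ℕ} (l : Fin N → ℕ) (k : ℕ) (hk : k < N) : shp N l (N - 1 - k) = l ⟨k, hk⟩ - k := by
  have h : N - 1 - k < N := by omega
  rw [shp, dif_pos h]
  have : (Fin.rev ⟨N - 1 - k, h⟩ : Fin N) = ⟨k, hk⟩ := by ext; simp [Fin.rev]; omega
  rw [this]; omega

lemma shp_zero {N : ℕ} (l : Fin N → ℕ) (i : ℕ) (hi : N ≤ i) : shp N l i = 0 := by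
  rw [shp, dif_neg (by omega)]

lemma shp_anti {N : ℕ} {l : Fin N → ℕ} (hl : StrictMono l) : Antitone (shp N l) := by
  apply antitone_nat_of_succ_le
  intro i
  rcases lt_or_ge (i+1) N with h | h
  · obtain ⟨k, rfl⟩ : ∃ k, N = k + 1 + i + 1 := ⟨N - i - 2, by omega⟩
    have e1 := shp_eq l k (by omega)
    have e2 := shp_eq l (k+1) (by omega)
    rw [show k + 1 + i + 1 - 1 - k = i + 1 by omega] at e1
    rw [show k + 1 + i + 1 - 1 - (k + 1) = i by omega] at e2
    rw [e1, e2]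
    have : l ⟨k, by omega⟩ < l ⟨k+1, by omega⟩ := hl (by simp)
    omega
  · rw [shp_zero l _ h]; omega

lemma det_step {N : ℕ} {l : Fin (N+1) → ℕ} (hl : StrictMono l) :
    (Matrix.of fun i j : Fin (N+1) => ((l i).choose j : ℤ)).det =
    ∑ m ∈ Fintype.piFinset (fun k : Fin N => Finset.Ico (l k.castSucc) (l k.succ)),
      (Matrix.of fun i j : Fin N => ((m i).choose j : ℤ)).det := by
  have e1 := Matrix.det_eq_of_forall_row_eq_smul_add_pred (R := ℤ)
    (A := Matrix.of fun i j : Fin (N+1) => ((l i).choose j : ℤ))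
    (B := Matrix.of fun i j : Fin (N+1) => Fin.cases (motive := fun _ => ℤ) ((l 0).choose j : ℤ)
      (fun i => ((l i.succ).choose j : ℤ) - ((l i.castSucc).choose j : ℤ)) i)
    (fun _ => 1) (by intro j; simp) (by intro i j; simp)
  rw [e1, Matrix.det_succ_column_zero, Fin.sum_univ_succ]
  simp only [Matrix.of_apply, Fin.cases_zero, Fin.cases_succ]
  simp
  have := (Matrix.detRowAlternating (R := ℤ) (n := Fin N)).toMultilinearMap.map_sum_finset
    (fun (i : Fin N) (m : ℕ) (j : Fin N) => (m.choose j : ℤ))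
    (fun k : Fin N => Finset.Ico (l k.castSucc) (l k.succ))
  refine Eq.trans ?_ this
  change Matrix.det _ = Matrix.det _
  congr 1
  ext i j
  simp only [Matrix.submatrix_apply, Matrix.of_apply, Fin.cases_succ, Finset.sum_apply]
  have hle : l i.castSucc ≤ l i.succ := hl.monotone (Fin.castSucc_le_succ i)
  generalize l i.castSucc = a at hle
  generalize l i.succ = b at hle
  induction hle with
  | refl => simp
  | step h ih =>
    rename_i b
    rw [Finset.sum_Ico_succ_top h, ← ih]
    simp [Nat.choose_succ_succ]
    ring

lemma main_count (N : ℕ) : ∀ l : Fin N → ℕ, StrictMono l → ∃ F : Finset (ℕ → ℕ → ℕ),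
    (∀ T, T ∈ F ↔ SS (shp N l) N T) ∧
    (F.card : ℤ) = (Matrix.of fun i j : Fin N => ((l i).choose j : ℤ)).det := by
  induction N with
  | zero =>
    intro l hl
    refine ⟨{fun _ _ => 0}, ?_, by simp⟩
    intro T
    have h0 : shp 0 l = fun _ => 0 := by ext i; exact shp_zero l i (by omega)
    rw [h0]
    simp only [Finset.mem_singleton, SS]
    constructor
    · rintro rfl; simp
    · intro h; ext i j; exact h.2.2.1 i j (by omega)
  | succ N ih =>
    intro l hl
    classical
    choose! F hF hc using ih
    set box := Fintype.piFinset (fun k : Fin N => Finset.Ico (l k.castSucc) (l k.succ)) with hbox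
    have hmono : ∀ m ∈ box, StrictMono m := by
      intro m hm
      rw [hbox, Fintype.mem_piFinset] at hm
      cases N with
      | zero => intro a; exact a.elim0
      | succ N =>
        rw [Fin.strictMono_iff_lt_succ]
        intro i
        have h1 := Finset.mem_Ico.1 (hm i.castSucc)
        have h2 := Finset.mem_Ico.1 (hm i.succ)
        rw [Fin.succ_castSucc] at h1
        omega
    have hint : ∀ m ∈ box, (∀ i, shp N m i ≤ shp (N+1) l i) ∧
        (∀ i, shp (N+1) l (i+1) ≤ shp N m i) := by
      intro m hm
      rw [hbox, Fintype.mem_piFinset] at hm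
      constructor
      · intro i
        rcases lt_or_ge i N with h | h
        · obtain ⟨k, rfl⟩ : ∃ k, N = k + i + 1 := ⟨N - i - 1, by omega⟩
          have e1 := shp_eq m k (by omega)
          have e2 := shp_eq l (k+1) (by omega)
          rw [show k + i + 1 - 1 - k = i by omega] at e1
          rw [show k + i + 1 + 1 - 1 - (k + 1) = i by omega] at e2
          have h1 := Finset.mem_Ico.1 (hm ⟨k, by omega⟩)
          rw [e1, e2]
          simp at h1
          omega
        · rw [shp_zero m i h]; omega
      · intro i
        rcases lt_or_ge i N with h | h
        · obtain ⟨k, rfl⟩ : ∃ k, N = k + i + 1 := ⟨N - i - 1, by omega⟩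
          have e1 := shp_eq m k (by omega)
          have e2 := shp_eq l k (by omega)
          rw [show k + i + 1 - 1 - k = i by omega] at e1
          rw [show k + i + 1 + 1 - 1 - k = i + 1 by omega] at e2
          have h1 := Finset.mem_Ico.1 (hm ⟨k, by omega⟩)
          rw [e1, e2]
          simp at h1
          omega
        · rw [shp_zero l _ (by omega)]; omega
    have hinj : ∀ m ∈ box, ∀ m' ∈ box, shp N m = shp N m' → m = m' := by
      intro m hm m' hm' h
      ext ⟨k, hk⟩
      have e1 := shp_eq m k hk
      have e2 := shp_eq m' k hk
      have := strictMono_le (hmono m hm) k hk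
      have := strictMono_le (hmono m' hm') k hk
      rw [h] at e1
      omega
    refine ⟨box.biUnion fun m => (F m).image (extT (shp (N+1) l) (shp N m) N), ?_, ?_⟩
    · intro T
      simp only [Finset.mem_biUnion, Finset.mem_image]
      constructor
      · rintro ⟨m, hm, T', hT', rfl⟩
        exact extT_mem (shp_anti hl) (hint m hm).1 (hint m hm).2
          ((hF m (hmono m hm) T').1 hT')
      · intro hT
        obtain ⟨s, h1, h2, h3, T', hT', rfl⟩ := extT_surj (shp_anti hl) hT
        have hs : shp N (fun k : Fin N => s (N - 1 - k) + k) = s := by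
          ext i
          rcases lt_or_ge i N with h | h
          · have := shp_eq (fun k : Fin N => s (N - 1 - k) + k) (N - 1 - i) (by omega)
            rw [show N - 1 - (N - 1 - i) = i by omega] at this
            rw [this]
            simp
          · rw [shp_zero _ _ h, h3 i h]
        have hm : (fun k : Fin N => s (N - 1 - k) + k) ∈ box := by
          rw [hbox, Fintype.mem_piFinset]
          rintro ⟨k, hk⟩
          have e1 := shp_eq l k (by omega)
          have e2 := shp_eq l (k+1) (by omega)
          rw [show N + 1 - 1 - k = N - 1 - k + 1 by omega] at e1
          rw [show N + 1 - 1 - (k+1) = N - 1 - k by omega] at e2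
          have := strictMono_le hl k (by omega)
          have := strictMono_le hl (k+1) (by omega)
          have g1 := h1 (N - 1 - k)
          have g2 := h2 (N - 1 - k)
          simp only [Finset.mem_Ico, Fin.castSucc_mk, Fin.succ_mk]
          omega
        refine ⟨_, hm, T', ?_, ?_⟩
        · rw [hF _ (hmono _ hm), hs]; exact hT'
        · rw [hs]
    · rw [Finset.card_biUnion, det_step hl]
      · push_cast
        refine Finset.sum_congr rfl fun m hm => ?_
        rw [← hc m (hmono m hm), Finset.card_image_of_injOn]
        intro T hT T' hT' h
        exact (extT_inj (hint m hm).1 (hint m hm).1 ((hF m (hmono m hm) T).1 hT)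
          ((hF m (hmono m hm) T').1 hT') h).2
      · intro m hm m' hm' hne
        rw [Function.onFun_apply, Finset.disjoint_left]
        intro T hT hT'
        obtain ⟨T1, hT1, rfl⟩ := Finset.mem_image.1 hT
        obtain ⟨T2, hT2, h⟩ := Finset.mem_image.1 hT'
        exact hne (hinj m hm m' hm' (extT_inj (hint m hm).1 (hint m' hm').1
          ((hF m (hmono m hm) T1).1 hT1)
          ((hF m' (hmono m' hm') T2).1 hT2) h.symm).1)

lemma det_choose {N : ℕ} (l : Fin N → ℕ) :
    (Matrix.of fun i j : Fin N => ((l i).choose j : ℤ)).det * ∏ k ∈ Finset.range N, (k.factorial : ℤ)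
     = ∏ j : Fin N, ∏ i ∈ Finset.Iio j, ((l j : ℤ) - l i) := by
  have h1 := Matrix.det_eval_matrixOfPolynomials_eq_det_vandermonde (fun i => (l i : ℤ))
    (fun j : Fin N => descPochhammer ℤ j) (fun i => descPochhammer_natDegree ℤ i)
    (fun i => monic_descPochhammer ℤ i)
  rw [Matrix.det_vandermonde] at h1
  rw [Finset.prod_comm' (t' := Finset.univ) (s' := fun i => Finset.Ioi i) (by simp), h1,
    ← Fin.prod_univ_eq_prod_range (fun k => (k.factorial : ℤ)), mul_comm, ← Matrix.det_mul_row]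
  congr 1
  ext i j
  simp only [Matrix.of_apply]
  rw [descPochhammer_eval_eq_descFactorial, Nat.descFactorial_eq_factorial_mul_choose]
  push_cast
  rfl

lemma hook_row (μ : YoungDiagram) (N j : ℕ) (hj : j < N) (h0 : ∀ i, N ≤ i → μ.rowLen i = 0) :
    (∏ c ∈ Finset.range (μ.rowLen (N - 1 - j)), hookLen μ (N - 1 - j) c) *
    ∏ k ∈ Finset.range j, ((μ.rowLen (N - 1 - j) + j) - (μ.rowLen (N - 1 - k) + k)) =
    (μ.rowLen (N - 1 - j) + j).factorial := by
  have hmem : ∀ i c, c < μ.rowLen i ↔ i < μ.colLen c := by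
    intro i c; rw [← YoungDiagram.mem_iff_lt_rowLen, YoungDiagram.mem_iff_lt_colLen]
  have hN : ∀ c, μ.colLen c ≤ N := by
    intro c
    by_contra! h
    have := (hmem N c).2 h
    rw [h0 N le_rfl] at this
    omega
  have hc := μ.colLen_anti
  have hr := μ.rowLen_anti
  set p := N - 1 - j with hp
  set R := μ.rowLen p with hR
  set b : ℕ → ℕ := fun k => (R + j) - (μ.rowLen (N - 1 - k) + k) with hb
  have ia : Set.InjOn (hookLen μ p) (Finset.range R) := by
    intro x hx y hy h
    simp only [Finset.coe_range, Set.mem_Iio] at hx hy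
    have h1 := (hmem _ _).1 hx
    have h2 := (hmem _ _).1 hy
    simp only [hookLen] at h
    rcases lt_trichotomy x y with g | g | g
    · have := hc x y g.le; omega
    · exact g
    · have := hc y x g.le; omega
  have ib : Set.InjOn b (Finset.range j) := by
    intro x hx y hy h
    simp only [Finset.coe_range, Set.mem_Iio] at hx hy
    simp only [hb] at h
    have h1 := hr p (N - 1 - x) (by omega)
    have h2 := hr p (N - 1 - y) (by omega)
    rcases lt_trichotomy x y with g | g | g
    · have := hr (N-1-y) (N-1-x) (by omega); omega
    · exact g
    · have := hr (N-1-x) (N-1-y) (by omega); omega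
  have hd : Disjoint ((Finset.range R).image (hookLen μ p)) ((Finset.range j).image b) := by
    rw [Finset.disjoint_left]
    intro t ht ht'
    obtain ⟨c, hcR, rfl⟩ := Finset.mem_image.1 ht
    obtain ⟨k, hk, h⟩ := Finset.mem_image.1 ht'
    simp only [Finset.mem_range] at hcR hk
    have h1 := (hmem _ _).1 hcR
    have h2 := hr p (N - 1 - k) (by omega)
    have h3 := hmem (N - 1 - k) c
    simp only [hb, hookLen] at h
    by_cases g : c < μ.rowLen (N - 1 - k)
    · have := h3.1 g; omega
    · have := h3.not.1 g; omega
  have hu : (Finset.range R).image (hookLen μ p) ∪ (Finset.range j).image b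
      = (Finset.range (R + j)).image (fun x => x + 1) := by
    apply Finset.eq_of_subset_of_card_le
    · intro t ht
      simp only [Finset.mem_image, Finset.mem_range]
      refine ⟨t - 1, ?_⟩
      rcases Finset.mem_union.1 ht with ht | ht
      · obtain ⟨c, hcR, rfl⟩ := Finset.mem_image.1 ht
        simp only [Finset.mem_range] at hcR
        have h1 := (hmem _ _).1 hcR
        have := hN c
        simp only [hookLen]
        omega
      · obtain ⟨k, hk, rfl⟩ := Finset.mem_image.1 ht
        simp only [Finset.mem_range] at hk
        have h2 := hr p (N - 1 - k) (by omega)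
        simp only [hb]
        omega
    · rw [Finset.card_union_of_disjoint hd, Finset.card_image_of_injOn ia,
        Finset.card_image_of_injOn ib]
      refine Finset.card_image_le.trans ?_
      simp
  rw [← Finset.prod_range_add_one_eq_factorial,
    ← Finset.prod_image (s := Finset.range (R + j)) (g := fun x => x + 1) (f := fun x => x)
      (by intro a _ b _ h; simpa using h), ← hu, Finset.prod_union hd,
    Finset.prod_image ia, Finset.prod_image ib]

lemma content_row (R j : ℕ) : (∏ c ∈ Finset.range R, ((j : ℤ) + 1 + c)) * (j.factorial : ℤ) =
    ((R + j).factorial : ℤ) := by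
  induction R with
  | zero => simp
  | succ R ih =>
    rw [Finset.prod_range_succ, show R + 1 + j = (R + j) + 1 by omega, Nat.factorial_succ]
    push_cast
    rw [← ih]; ring

/-- The Hook Content Formula: for a nonempty Young diagram `μ`, the number of
semistandard Young tableaux of shape `μ` with entries in `{0, …, N-1}` times the product
of the hook lengths equals `∏_{(i,j) ∈ μ} (N + j - i)`. -/
theorem statement9 (μ : YoungDiagram) (hμ : μ ≠ ⊥) (N : ℕ) :
    (Nat.card {T : SemistandardYoungTableau μ // ∀ i j : ℕ, (i, j) ∈ μ → T i j < N} : ℤ) *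
        ∏ c ∈ μ.cells, (hookLen μ c.1 c.2 : ℤ)
      = ∏ c ∈ μ.cells, ((N : ℤ) + (c.2 : ℤ) - (c.1 : ℤ)) := by
  by_cases hN : (N, 0) ∈ μ
  · have : IsEmpty {T : SemistandardYoungTableau μ // ∀ i j : ℕ, (i, j) ∈ μ → T i j < N} := by
      constructor
      rintro ⟨T, hT⟩
      have hge : ∀ i, (i, 0) ∈ μ → i ≤ T i 0 := by
        intro i
        induction i with
        | zero => intro _; exact Nat.zero_le _
        | succ i ih =>
          intro h
          have := T.col_strict (show i < i + 1 by omega) h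
          have := ih (μ.up_left_mem (Nat.le_succ i) le_rfl h)
          omega
      have := hT N 0 hN
      have := hge N hN
      omega
    rw [Nat.card_of_isEmpty, Nat.cast_zero, zero_mul]
    symm
    exact Finset.prod_eq_zero (i := (N, 0)) ((YoungDiagram.mem_cells _).2 hN) (by simp)
  have h0 : ∀ i, N ≤ i → μ.rowLen i = 0 := by
    intro i hi
    rw [YoungDiagram.mem_iff_lt_rowLen] at hN
    have := μ.rowLen_anti N i hi
    omega
  have hcells : ∀ f : ℕ × ℕ → ℤ, ∏ c ∈ μ.cells, f c =
      ∏ j ∈ Finset.range N, ∏ c ∈ Finset.range (μ.rowLen (N - 1 - j)), f (N - 1 - j, c) := by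
    intro f
    rw [Finset.prod_range_reflect (fun i => ∏ c ∈ Finset.range (μ.rowLen i), f (i, c)) N]
    apply Finset.prod_finset_product
    rintro ⟨i, c⟩
    rw [YoungDiagram.mem_cells, YoungDiagram.mem_iff_lt_rowLen]
    simp only [Finset.mem_range]
    constructor
    · intro h
      refine ⟨?_, h⟩
      by_contra! h'
      rw [h0 i h'] at h
      omega
    · exact fun h => h.2
  set l : Fin N → ℕ := fun k => μ.rowLen (N - 1 - k) + k with hl
  have hlm : StrictMono l := by
    intro a b hab
    have h1 : (a : ℕ) < b := hab
    have := μ.rowLen_anti (N - 1 - b) (N - 1 - a) (by omega)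
    simp only [hl]
    omega
  have hshp : shp N l = μ.rowLen := by
    ext i
    rcases lt_or_ge i N with h | h
    · have := shp_eq l (N - 1 - i) (by omega)
      rw [show N - 1 - (N - 1 - i) = i by omega] at this
      rw [this]
      simp only [hl]
      rw [show N - 1 - (N - 1 - i) = i by omega]
      omega
    · rw [shp_zero _ _ h, h0 i h]
  obtain ⟨F, hF, hcard⟩ := main_count N l hlm
  rw [hshp] at hF
  have hcard2 : Nat.card {T : SemistandardYoungTableau μ // ∀ i j : ℕ, (i, j) ∈ μ → T i j < N}
      = F.card := by
    have hFc : Nat.card (F : Set (ℕ → ℕ → ℕ)) = F.card := by simp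
    rw [← hFc]
    refine Nat.card_congr ⟨fun T => ⟨fun i j => T.1 i j, ?_⟩, fun T => ⟨⟨T.1, ?_, ?_, ?_⟩, ?_⟩, ?_, ?_⟩
    · rw [Finset.mem_coe, hF]
      refine ⟨?_, ?_, ?_, ?_⟩
      · intro i j1 j2 hj h
        exact T.1.row_weak hj (YoungDiagram.mem_iff_lt_rowLen.2 h)
      · intro i1 i2 j hj h
        exact T.1.col_strict hj (YoungDiagram.mem_iff_lt_rowLen.2 h)
      · intro i j h
        exact T.1.zeros (by rw [YoungDiagram.mem_iff_lt_rowLen]; omega)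
      · intro i j h
        exact T.2 i j (YoungDiagram.mem_iff_lt_rowLen.2 h)
    · intro i j1 j2 hj h
      exact ((hF _).1 T.2).1 i j1 j2 hj (YoungDiagram.mem_iff_lt_rowLen.1 h)
    · intro i1 i2 j hj h
      exact ((hF _).1 T.2).2.1 i1 i2 j hj (YoungDiagram.mem_iff_lt_rowLen.1 h)
    · intro i j h
      rw [YoungDiagram.mem_iff_lt_rowLen] at h
      exact ((hF _).1 T.2).2.2.1 i j (by omega)
    · intro i j h
      exact ((hF _).1 T.2).2.2.2 i j (YoungDiagram.mem_iff_lt_rowLen.1 h)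
    · intro T; rfl
    · intro T; rfl
  rw [hcard2, hcells, hcells]
  have hdet := det_choose l
  rw [← hcard] at hdet
  have hV : ∏ j : Fin N, ∏ i ∈ Finset.Iio j, ((l j : ℤ) - l i) =
      ∏ j ∈ Finset.range N, ∏ k ∈ Finset.range j,
        (((μ.rowLen (N - 1 - j) + j) - (μ.rowLen (N - 1 - k) + k) : ℕ) : ℤ) := by
    rw [← Fin.prod_univ_eq_prod_range (fun j => ∏ k ∈ Finset.range j,
        (((μ.rowLen (N - 1 - j) + j) - (μ.rowLen (N - 1 - k) + k) : ℕ) : ℤ))]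
    refine Finset.prod_congr rfl fun j _ => ?_
    refine Finset.prod_bij (fun i _ => (i : ℕ)) ?_ ?_ ?_ ?_
    · intro a ha
      simpa using ha
    · intro a _ b _ h
      exact Fin.ext h
    · intro b hb
      have hb' := Finset.mem_range.1 hb
      exact ⟨⟨b, by omega⟩, by simpa [Fin.lt_def] using hb', rfl⟩
    · intro a ha
      have : l a < l j := hlm (Finset.mem_Iio.1 ha)
      rw [← Nat.cast_sub this.le]
  rw [hV] at hdet
  have hf : (∏ k ∈ Finset.range N, (k.factorial : ℤ)) ≠ 0 :=
    Finset.prod_ne_zero_iff.2 fun k _ => by exact_mod_cast k.factorial_ne_zero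
  apply mul_right_cancel₀ hf
  rw [mul_right_comm, hdet, ← Finset.prod_mul_distrib, ← Finset.prod_mul_distrib]
  refine Finset.prod_congr rfl fun j hj => ?_
  have hj' := Finset.mem_range.1 hj
  have h1 := hook_row μ N j hj' h0
  rw [mul_comm]
  have h2 : ∏ c ∈ Finset.range (μ.rowLen (N - 1 - j)), ((N : ℤ) + (c : ℤ) - ((N - 1 - j : ℕ) : ℤ))
      = ∏ c ∈ Finset.range (μ.rowLen (N - 1 - j)), ((j : ℤ) + 1 + c) := by
    refine Finset.prod_congr rfl fun c _ => ?_
    omega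
  rw [h2, content_row, ← h1]
  push_cast
  rfl
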